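/- Fix a > 0 and define P(x,a) = C₃(x)a³ + C₂(x)a² + C₁(x)a + C₀(x), where C₀(x) = e^{6x}x⁴, C₁(x) = e^{6x}(4x³−x²+3x−3)+e^{4x}(−4x³+x²+3x+3), C₂(x) = e^{6x}(5x²+x)+e^{4x}(−12x²+6x−12)+e^{2x}(15x²+17x+12), C₃(x) = e^{6x}(2x+2)+e^{4x}(−8x−10)+e^{2x}(30x+2)+6. Then P(x,a) ≥ 0 for all x ∈ ℝ and a > 0. -/

import Mathlib

theorem step_aux (f g : ℝ → ℝ) (hd : ∀ x, HasDerivAt f (g x) x) (h0 : 0 ≤ f 0)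
    (hg : ∀ x, 0 ≤ x → 0 ≤ g x) : ∀ x, 0 ≤ x → 0 ≤ f x := by
  intro x hx
  have hm : MonotoneOn f (Set.Ici 0) := by
    apply monotoneOn_of_deriv_nonneg (convex_Ici 0)
    · exact fun y _ => (hd y).continuousAt.continuousWithinAt
    · exact fun y _ => (hd y).differentiableAt.differentiableWithinAt
    · intro y hy
      rw [interior_Ici] at hy
      rw [(hd y).deriv]
      exact hg y (le_of_lt hy)
  exact h0.trans (hm (Set.mem_Ici.2 le_rfl) (Set.mem_Ici.2 hx) hx)

theorem exp_aux (x : ℝ) : HasDerivAt (fun x => Real.exp (2*x)) (2 * Real.exp (2*x)) x := by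
  have h := ((hasDerivAt_id x).const_mul 2).exp
  simpa [mul_comm] using h


/-- Coefficients of a cubic polynomial. -/
structure CubicPoly4 where
  c0 : ℝ
  c1 : ℝ
  c2 : ℝ
  c3 : ℝ

/-- Evaluation of a cubic polynomial. -/
def CubicPoly4.ev (p : CubicPoly4) (x : ℝ) : ℝ := p.c0 + p.c1 * x + p.c2 * x^2 + p.c3 * x^3

/-- If `p` is the coefficient of `exp (m x)`, then `p.dd m` is that of the derivative. -/
def CubicPoly4.dd (p : CubicPoly4) (m : ℝ) : CubicPoly4 :=
  ⟨p.c1 + m * p.c0, 2 * p.c2 + m * p.c1, 3 * p.c3 + m * p.c2, m * p.c3⟩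

/-- All coefficients are nonnegative. -/
def CubicPoly4.Nonneg (p : CubicPoly4) : Prop := 0 ≤ p.c0 ∧ 0 ≤ p.c1 ∧ 0 ≤ p.c2 ∧ 0 ≤ p.c3

theorem CubicPoly4.Nonneg.ev {p : CubicPoly4} (h : p.Nonneg) {x : ℝ} (hx : 0 ≤ x) : 0 ≤ p.ev x := by
  obtain ⟨h0, h1, h2, h3⟩ := h
  unfold CubicPoly4.ev
  positivity

/-- The exponential polynomial with the given coefficients. -/
noncomputable def EP (p q r s : CubicPoly4) (x : ℝ) : ℝ :=
  p.ev x + q.ev x * Real.exp (2*x) + r.ev x * Real.exp (2*x)^2 + s.ev x * Real.exp (2*x)^3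

/-- Nonnegativity of the exponential polynomial on the half line. -/
def EPNonneg (p q r s : CubicPoly4) : Prop := ∀ x : ℝ, 0 ≤ x → 0 ≤ EP p q r s x

theorem CubicPoly4.hasDerivAt (p : CubicPoly4) (x : ℝ) :
    HasDerivAt p.ev (p.c1 + 2 * p.c2 * x + 3 * p.c3 * x^2) x := by
  have hi := hasDerivAt_id' x
  have h := (((hasDerivAt_const x p.c0).add (hi.const_mul p.c1)).add
    ((hi.pow 2).const_mul p.c2)).add ((hi.pow 3).const_mul p.c3)
  refine h.congr_deriv ?_
  push_cast
  ring

theorem EP_hasDerivAt (p q r s : CubicPoly4) (x : ℝ) :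
    HasDerivAt (EP p q r s) (EP (p.dd 0) (q.dd 2) (r.dd 4) (s.dd 6) x) x := by
  have hE := exp_aux x
  have h := (((p.hasDerivAt x).add ((q.hasDerivAt x).mul hE)).add
    ((r.hasDerivAt x).mul (hE.pow 2))).add ((s.hasDerivAt x).mul (hE.pow 3))
  refine h.congr_deriv ?_
  simp only [EP, CubicPoly4.ev, CubicPoly4.dd, Pi.pow_apply]
  push_cast
  ring

theorem stepD {p q r s : CubicPoly4} (h0 : 0 ≤ p.c0 + q.c0 + r.c0 + s.c0)
    (h : EPNonneg (p.dd 0) (q.dd 2) (r.dd 4) (s.dd 6)) : EPNonneg p q r s :=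
  step_aux _ _ (EP_hasDerivAt p q r s) (by simpa [EP, CubicPoly4.ev] using h0) h

theorem stepE {p q r s : CubicPoly4} (h0 : p = ⟨0, 0, 0, 0⟩)
    (h : EPNonneg q r s ⟨0, 0, 0, 0⟩) : EPNonneg p q r s := by
  intro x hx
  have h1 := mul_nonneg (h x hx) (Real.exp_pos (2*x)).le
  refine h1.trans_eq ?_
  subst h0
  simp only [EP, CubicPoly4.ev]
  ring

theorem stepN {p q r s : CubicPoly4} (hp : p.Nonneg) (hq : q.Nonneg) (hr : r.Nonneg)
    (hs : s.Nonneg) : EPNonneg p q r s := by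
  intro x hx
  have := hp.ev hx
  have := hq.ev hx
  have := hr.ev hx
  have := hs.ev hx
  unfold EP
  positivity

theorem c1p : EPNonneg ⟨3, 3, 1, -4⟩ ⟨-3, 3, -1, 4⟩ ⟨0, 0, 0, 0⟩ ⟨0, 0, 0, 0⟩ := by
  refine stepD ?_ (stepD ?_ (stepD ?_ (stepD ?_ (stepN ?_ ?_ ?_ ?_)))) <;>
    norm_num [CubicPoly4.dd, CubicPoly4.Nonneg]

theorem c2p : EPNonneg ⟨12, 17, 15, 0⟩ ⟨-12, 6, -12, 0⟩ ⟨0, 1, 5, 0⟩ ⟨0, 0, 0, 0⟩ := by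
  refine stepD ?_ (stepD ?_ (stepD ?_ (stepE ?_ (stepD ?_ (stepD ?_ (stepD ?_ (stepN ?_ ?_ ?_ ?_))))))) <;>
    norm_num [CubicPoly4.dd, CubicPoly4.Nonneg]

theorem c3p : EPNonneg ⟨6, 0, 0, 0⟩ ⟨2, 30, 0, 0⟩ ⟨-10, -8, 0, 0⟩ ⟨2, 2, 0, 0⟩ := by
  refine stepD ?_ (stepE ?_ (stepD ?_ (stepD ?_ (stepE ?_ (stepD ?_ (stepD ?_ (stepN ?_ ?_ ?_ ?_))))))) <;>
    norm_num [CubicPoly4.dd, CubicPoly4.Nonneg]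

theorem c1n : EPNonneg ⟨-3, -3, -1, -4⟩ ⟨3, -3, 1, 4⟩ ⟨0, 0, 0, 0⟩ ⟨0, 0, 0, 0⟩ := by
  refine stepD ?_ (stepD ?_ (stepD ?_ (stepD ?_ (stepN ?_ ?_ ?_ ?_)))) <;>
    norm_num [CubicPoly4.dd, CubicPoly4.Nonneg]

theorem c2n : EPNonneg ⟨0, -1, 5, 0⟩ ⟨-12, -6, -12, 0⟩ ⟨12, -17, 15, 0⟩ ⟨0, 0, 0, 0⟩ := by
  refine stepD ?_ (stepD ?_ (stepD ?_ (stepE ?_ (stepD ?_ (stepD ?_ (stepD ?_ (stepN ?_ ?_ ?_ ?_))))))) <;>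
    norm_num [CubicPoly4.dd, CubicPoly4.Nonneg]

theorem c3n : EPNonneg ⟨2, -2, 0, 0⟩ ⟨-10, 8, 0, 0⟩ ⟨2, -30, 0, 0⟩ ⟨6, 0, 0, 0⟩ := by
  refine stepD ?_ (stepD ?_ (stepE ?_ (stepD ?_ (stepD ?_ (stepE ?_ (stepD ?_ (stepD ?_ (stepN ?_ ?_ ?_ ?_)))))))) <;>
    norm_num [CubicPoly4.dd, CubicPoly4.Nonneg]

theorem P_nonneg (C₀ C₁ C₂ C₃ : ℝ → ℝ) (P : ℝ × ℝ → ℝ)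
    (hC0 : ∀ x, C₀ x = Real.exp (6*x) * x^4)
    (hC1 : ∀ x, C₁ x = Real.exp (6*x) * (4*x^3 - x^2 + 3*x - 3)
      + Real.exp (4*x) * (-4*x^3 + x^2 + 3*x + 3))
    (hC2 : ∀ x, C₂ x = Real.exp (6*x) * (5*x^2 + x) + Real.exp (4*x) * (-12*x^2 + 6*x - 12)
      + Real.exp (2*x) * (15*x^2 + 17*x + 12))
    (hC3 : ∀ x, C₃ x = Real.exp (6*x) * (2*x + 2) + Real.exp (4*x) * (-8*x - 10)
      + Real.exp (2*x) * (30*x + 2) + 6)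
    (hP : ∀ x a, P (x, a) = C₃ x * a^3 + C₂ x * a^2 + C₁ x * a + C₀ x) :
    ∀ x a : ℝ, 0 < a → 0 ≤ P (x, a) := by
  intro x a ha
  rw [hP, hC0, hC1, hC2, hC3]
  have e4 : Real.exp (4*x) = Real.exp (2*x)^2 := by
    rw [← Real.exp_nat_mul]; congr 1; push_cast; ring
  have e6 : Real.exp (6*x) = Real.exp (2*x)^3 := by
    rw [← Real.exp_nat_mul]; congr 1; push_cast; ring
  rw [e4, e6]
  have hE := Real.exp_pos (2*x)
  have key : 0 ≤ (3 + 3*x + x^2 - 4*x^3) + (-3 + 3*x - x^2 + 4*x^3) * Real.exp (2*x) ∧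
      0 ≤ (12 + 17*x + 15*x^2) + (-12 + 6*x - 12*x^2) * Real.exp (2*x)
        + (x + 5*x^2) * Real.exp (2*x)^2 ∧
      0 ≤ 6 + (2 + 30*x) * Real.exp (2*x) + (-10 - 8*x) * Real.exp (2*x)^2
        + (2 + 2*x) * Real.exp (2*x)^3 := by
    rcases le_total 0 x with hx | hx
    · refine ⟨(c1p x hx).trans_eq ?_, (c2p x hx).trans_eq ?_, (c3p x hx).trans_eq ?_⟩ <;>
        simp only [EP, CubicPoly4.ev] <;> ring
    · have hy : 0 ≤ -x := by linarith
      have hinv : Real.exp (2 * -x) * Real.exp (2*x) = 1 := by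
        rw [← Real.exp_add]; simp
      have h1 := mul_nonneg (c1n (-x) hy) hE.le
      have h2 := mul_nonneg (c2n (-x) hy) (pow_pos hE 2).le
      have h3 := mul_nonneg (c3n (-x) hy) (pow_pos hE 3).le
      simp only [EP, CubicPoly4.ev] at h1 h2 h3
      generalize Real.exp (2 * -x) = F at *
      generalize Real.exp (2 * x) = E at *
      have i2 : F^2 * E^2 = 1 := by rw [← mul_pow, hinv, one_pow]
      have i3 : F^3 * E^3 = 1 := by rw [← mul_pow, hinv, one_pow]
      refine ⟨h1.trans_eq ?_, h2.trans_eq ?_, h3.trans_eq ?_⟩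
      · linear_combination (3 + 3*x + x^2 - 4*x^3) * hinv
      · linear_combination (12 + 17*x + 15*x^2) * i2 + (-12 + 6*x - 12*x^2) * E * hinv
      · linear_combination 6 * i3 + (2 + 30*x) * E * i2 + (-10 - 8*x) * E^2 * hinv
  obtain ⟨k1, k2, k3⟩ := key
  have h := add_nonneg (add_nonneg (add_nonneg (mul_nonneg k3 (pow_pos ha 3).le)
    (mul_nonneg (mul_nonneg k2 hE.le) (pow_pos ha 2).le))
    (mul_nonneg (mul_nonneg k1 (pow_pos hE 2).le) ha.le))
    (mul_nonneg (pow_pos hE 3).le (by positivity : (0:ℝ) ≤ x^4))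
  refine h.trans_eq ?_
  ring
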